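/- The partial sums ∑_{k=1}^N 1/(3k−2) satisfy: the limit as N → ∞ of (∑_{k=1}^N 1/(3k−2) − (1/3)·log N) exists and equals γ/3 + (1/2)·log 3 + π/(6√3). -/

import Mathlib

open Real Filter

theorem sum_inv_three_mul_add_one_add_sum_inv_three_mul_add_two (N : ℕ) :
    (∑ k ∈ Finset.range N, 1 / (3 * (k : ℝ) + 1)) + ∑ k ∈ Finset.range N, 1 / (3 * (k : ℝ) + 2) =
      harmonic (3 * N) - harmonic N / 3 := by
  induction N with
  | zero => simp
  | succ n ih =>
    rw [Finset.sum_range_succ, Finset.sum_range_succ, show 3 * (n + 1) = 3 * n + 1 + 1 + 1 by ring,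
      harmonic_succ, harmonic_succ, harmonic_succ, harmonic_succ]
    push_cast
    rw [add_add_add_comm, ih]
    field_simp
    ring

theorem real_cot_pi_div_three : Real.cot (π / 3) = 1 / √3 := by
  rw [Real.cot_eq_cos_div_sin, Real.cos_pi_div_three, Real.sin_pi_div_three]
  field_simp

theorem one_third_mem_integerComplement : (1 / 3 : ℂ) ∈ Complex.integerComplement := by
  rintro ⟨n, hn⟩
  have h : (3 * n : ℂ) = 1 := by rw [hn]; norm_num
  have h' : 3 * n = 1 := by exact_mod_cast h
  omega

theorem sum_cotTerm_one_third (N : ℕ) :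
    ∑ n ∈ Finset.range N, cotTerm (1 / 3) n =
      ((3 * ((∑ k ∈ Finset.range N, 1 / (3 * (k : ℝ) + 1)) -
        ∑ k ∈ Finset.range N, 1 / (3 * (k : ℝ) + 2)) + 3 / (3 * (N : ℝ) + 1) - 3 : ℝ) : ℂ) := by
  induction N with
  | zero => simp
  | succ n ih =>
    have hterm : cotTerm (1 / 3) n =
        ((3 / (3 * (n : ℝ) + 4) - 3 / (3 * (n : ℝ) + 2) : ℝ) : ℂ) := by
      have h₁ : (1 / 3 - (n + 1) : ℂ) = ((-((3 * n + 2) / 3) : ℝ) : ℂ) := by push_cast; ring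
      have h₂ : (1 / 3 + (n + 1) : ℂ) = (((3 * n + 4) / 3 : ℝ) : ℂ) := by push_cast; ring
      rw [cotTerm, h₁, h₂]
      norm_cast
      field_simp
      ring
    rw [Finset.sum_range_succ, ih, hterm, ← Complex.ofReal_add, Finset.sum_range_succ,
      Finset.sum_range_succ]
    congr 1
    push_cast
    field_simp
    ring

theorem tendsto_sum_inv_three_mul_add_one_sub_sum_inv_three_mul_add_two :
    Tendsto (fun N : ℕ => (∑ k ∈ Finset.range N, 1 / (3 * (k : ℝ) + 1)) -
      ∑ k ∈ Finset.range N, 1 / (3 * (k : ℝ) + 2)) atTop (nhds (π / (3 * √3))) := by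
  have hcot := tendsto_logDeriv_euler_cot_sub one_third_mem_integerComplement
  have hval : (π * Complex.cot (π * (1 / 3)) - 1 / (1 / 3) : ℂ) = ((π / √3 - 3 : ℝ) : ℂ) := by
    have harg : (π * (1 / 3) : ℂ) = ((π / 3 : ℝ) : ℂ) := by push_cast; ring
    rw [harg, ← Complex.ofReal_cot, real_cot_pi_div_three]
    push_cast
    ring
  simp only [sum_cotTerm_one_third] at hcot
  rw [hval] at hcot
  have hre := (Complex.continuous_re.tendsto _).comp hcot
  simp only [Function.comp_def, Complex.ofReal_re] at hre
  have hinv : Tendsto (fun N : ℕ => 3 / (3 * (N : ℝ) + 1)) atTop (nhds 0) :=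
    (tendsto_atTop_add_const_right _ 1
      (tendsto_natCast_atTop_atTop.const_mul_atTop three_pos)).const_div_atTop 3
  have h := ((hre.add_const 3).sub hinv).div_const 3
  convert h using 2
  · ring
  · field_simp
    ring

theorem partial_sums_three_n_sub_two_asymptotic :
    Tendsto (fun N : ℕ =>
        (∑ k ∈ Finset.range N, 1 / (3 * ((k : ℝ) + 1) - 2)) - (1 / 3) * Real.log N)
      atTop (nhds (Real.eulerMascheroniConstant / 3 + (1 / 2) * Real.log 3 +
        Real.pi / (6 * Real.sqrt 3))) := by
  have hγ := Real.tendsto_harmonic_sub_log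
  have hγ' := hγ.comp (tendsto_id.const_mul_atTop' (show 0 < 3 by norm_num))
  have h := (((hγ'.sub (hγ.div_const 3)).add_const (log 3)).add
    tendsto_sum_inv_three_mul_add_one_sub_sum_inv_three_mul_add_two).div_const 2
  convert h.congr' ?_ using 2
  · field_simp
    ring
  filter_upwards [eventually_gt_atTop 0] with N hN
  have hN' : (N : ℝ) ≠ 0 := by positivity
  have hsum : ∑ k ∈ Finset.range N, 1 / (3 * ((k : ℝ) + 1) - 2) =
      ∑ k ∈ Finset.range N, 1 / (3 * (k : ℝ) + 1) :=
    Finset.sum_congr rfl fun k _ => by ring_nf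
  have hadd := sum_inv_three_mul_add_one_add_sum_inv_three_mul_add_two N
  simp only [Function.comp_apply, id_eq]
  rw [hsum, Nat.cast_mul, Nat.cast_ofNat, log_mul three_ne_zero hN']
  linarith
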